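/- Let s, t ∈ Tn and let C be a context (a term with exactly one occurrence of the hole □) such that C[s] ∈ Tn. If N(s) ≻_ℓ N(t) for some ℓ ≥ 1, then N(C[s]) ≻_ℓ N(C[t]). -/

import Mathlib

set_option maxHeartbeats 1000000

/-- First-order terms over a signature `F`, with variables drawn from `ℕ`. -/
inductive Tm (F : Type) : Type
  | var : ℕ → Tm F
  | fn  : F → List (Tm F) → Tm F

instance {F : Type} : Inhabited (Tm F) := ⟨Tm.var 0⟩

/-- The size `|t|` of a term. -/
def Tm.size {F} : Tm F → ℕ
  | .var _ => 1
  | .fn _ ts => 1 + (ts.attach.map fun t => t.1.size).sum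
decreasing_by have := List.sizeOf_lt_of_mem t.2; simp_wf; omega

/-- The depth of a term (variables and constants have depth 0). -/
def Tm.depth {F} : Tm F → ℕ
  | .var _ => 0
  | .fn _ [] => 0
  | .fn f (t :: ts) => max (t.depth + 1) (Tm.fn f ts).depth

/-- A (quasi-)precedence: a preorder `le` (i.e. `f ≿ g`) on the signature whose
strict part `≻` is well-founded. -/
structure Precedence (F : Type) where
  le : F → F → Prop
  refl : ∀ f, le f f
  trans : ∀ {f g h}, le f g → le g h → le f h
  wf : WellFounded (fun g f => le f g ∧ ¬ le g f)

/-- The strict part `f ≻ g` of a precedence. -/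
def Precedence.strict {F} (P : Precedence F) (f g : F) : Prop := P.le f g ∧ ¬ P.le g f

/-- The equivalence part `f ∼ g` of a precedence. -/
def Precedence.equiv {F} (P : Precedence F) (f g : F) : Prop := P.le f g ∧ P.le g f

/-- Term equivalence `s ≈ t` induced by the equivalence part of a precedence. -/
inductive TmEq {F} (P : Precedence F) : Tm F → Tm F → Prop
  | refl (t) : TmEq P t t
  | fn {f g : F} {ss ts : List (Tm F)} :
      P.equiv f g → ss.length = ts.length →
      (∀ i, i < ss.length → TmEq P (ss.getD i default) (ts.getD i default)) →
      TmEq P (.fn f ss) (.fn g ts)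

/-- `s` is a strict superterm of `t` modulo term equivalence `≈`. -/
inductive StrictSup {F} (P : Precedence F) : Tm F → Tm F → Prop
  | here {f : F} {ss : List (Tm F)} {s t : Tm F} :
      s ∈ ss → TmEq P s t → StrictSup P (.fn f ss) t
  | there {f : F} {ss : List (Tm F)} {s t : Tm F} :
      s ∈ ss → StrictSup P s t → StrictSup P (.fn f ss) t

mutual
/-- The order `a ≻_k b` (EPO) on finite sequences of terms, w.r.t. precedence
`P` and defined-symbol predicate `D`; terms are identified with singleton
sequences, `++` is concatenation. -/
inductive Epo {F} (P : Precedence F) (D : F → Bool) (k : ℕ) :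
    List (Tm F) → List (Tm F) → Prop
  /- (1) `a = f(s₁,…,s_m)` and `sᵢ (≻_k ∪ ≈) b` for some `i` -/
  | arg {f : F} {ss : List (Tm F)} {s : Tm F} {b : List (Tm F)} :
      s ∈ ss → EpoEq P D k [s] b → Epo P D k [Tm.fn f ss] b
  /- (2) `a = f(s₁,…,s_m)`, `f` defined, `b = [t₁ … t_n]` with `n = 0` or
     `2 ≤ n ≤ k`, and `a ≻_k t_j` for all `j` -/
  | seq {f : F} {ss ts : List (Tm F)} :
      D f = true →
      (ts.length = 0 ∨ (2 ≤ ts.length ∧ ts.length ≤ k)) →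
      (∀ t ∈ ts, Epo P D k [Tm.fn f ss] [t]) →
      Epo P D k [Tm.fn f ss] ts
  /- (3) `a = f(…)`, `f` defined, `b = g(t₁,…,t_n)` with `n ≤ k`, `f ≻ g`, and
     `a` is a strict superterm modulo `≈` of every `t_j` -/
  | prec {f g : F} {ss ts : List (Tm F)} :
      D f = true → P.strict f g → ts.length ≤ k →
      (∀ t ∈ ts, StrictSup P (Tm.fn f ss) t) →
      Epo P D k [Tm.fn f ss] [Tm.fn g ts]
  /- (4) `a = [s₁ … s_m]`, `b = b₁ ++ ⋯ ++ b_m`, and for some `j`: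
     `sᵢ ≈ bᵢ` for `i < j`, `s_j ≻_k b_j`, and `sᵢ (≻_k ∪ ≈) bᵢ` for `i > j` -/
  | lst {ss : List (Tm F)} {bs : List (List (Tm F))} {j : ℕ} :
      bs.length = ss.length → j < ss.length →
      (∀ i, i < j → ∃ t, bs.getD i [] = [t] ∧ TmEq P (ss.getD i default) t) →
      Epo P D k [ss.getD j default] (bs.getD j []) →
      (∀ i, j < i → i < ss.length → EpoEq P D k [ss.getD i default] (bs.getD i [])) →
      Epo P D k ss bs.flatten
  /- (5) `a = f(s₁,…,s_m)`, `b = g(t₁,…,t_n)` with `n ≤ k`, `f ∼ g` both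
     defined, and for some `j ≤ min(m,n)`: `sᵢ ≈ tᵢ` for `i < j`, `s_j` is a
     strict superterm mod `≈` of `t_j`, and `a` is a strict superterm mod `≈`
     of `tᵢ` for `i > j` -/
  | equiv {f g : F} {ss ts : List (Tm F)} {j : ℕ} :
      D f = true → D g = true → P.equiv f g → ts.length ≤ k →
      j < ss.length → j < ts.length →
      (∀ i, i < j → TmEq P (ss.getD i default) (ts.getD i default)) →
      StrictSup P (ss.getD j default) (ts.getD j default) →
      (∀ i, j < i → i < ts.length → StrictSup P (Tm.fn f ss) (ts.getD i default)) →
      Epo P D k [Tm.fn f ss] [Tm.fn g ts]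

/-- `≻_k ∪ ≈` (terms identified with singleton sequences). -/
inductive EpoEq {F} (P : Precedence F) (D : F → Bool) (k : ℕ) :
    List (Tm F) → List (Tm F) → Prop
  | epo {a b} : Epo P D k a b → EpoEq P D k a b
  | eq {s t : Tm F} : TmEq P s t → EpoEq P D k [s] [t]
end

/-- Constructor terms: terms built from constructors and variables only. -/
inductive IsCtorTerm {F} (D : F → Bool) : Tm F → Prop
  | var (v) : IsCtorTerm D (.var v)
  | fn {f : F} {ts : List (Tm F)} :
      D f = false → (∀ t ∈ ts, IsCtorTerm D t) → IsCtorTerm D (.fn f ts)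

/-- Basic terms: a defined root symbol applied to constructor terms. -/
def Basic {F} (D : F → Bool) (t : Tm F) : Prop :=
  ∃ f ts, t = Tm.fn f ts ∧ D f = true ∧ ∀ s ∈ ts, IsCtorTerm D s

/-- Application of a substitution `σ : V → T(F,V)` to a term. -/
def subst {F} (σ : ℕ → Tm F) : Tm F → Tm F
  | .var v => σ v
  | .fn f ts => .fn f (ts.attach.map fun t => subst σ t.1)
decreasing_by have := List.sizeOf_lt_of_mem t.2; simp_wf; omega

/-- The variable `v` occurs in the term. -/
inductive VarIn {F} (v : ℕ) : Tm F → Prop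
  | var : VarIn v (.var v)
  | fn {f : F} {ts : List (Tm F)} {t : Tm F} : t ∈ ts → VarIn v t → VarIn v (.fn f ts)

/-- A term rewrite system: left-hand sides are not variables and all variables
of a right-hand side occur in the corresponding left-hand side. -/
def IsTRS {F} (R : Set (Tm F × Tm F)) : Prop :=
  ∀ lr ∈ R, (∀ v, lr.1 ≠ Tm.var v) ∧ (∀ v, VarIn v lr.2 → VarIn v lr.1)

/-- A constructor TRS: all left-hand sides are basic terms. -/
def ConstructorTRS {F} (D : F → Bool) (R : Set (Tm F × Tm F)) : Prop :=
  ∀ lr ∈ R, Basic D lr.1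

/-- The rewrite relation `→_R` induced by `R`. -/
inductive Rew {F} (R : Set (Tm F × Tm F)) : Tm F → Tm F → Prop
  | root {l r : Tm F} {σ : ℕ → Tm F} :
      (l, r) ∈ R → Rew R (subst σ l) (subst σ r)
  | congr {f : F} {pre post : List (Tm F)} {s t : Tm F} :
      Rew R s t → Rew R (.fn f (pre ++ s :: post)) (.fn f (pre ++ t :: post))

/-- `t` is an `R`-normal form. -/
def NFo {F} (R : Set (Tm F × Tm F)) (t : Tm F) : Prop := ∀ u, ¬ Rew R t u

/-- The innermost rewrite relation `i→_R`: contracted redexes have all their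
proper subterms in normal form. -/
inductive IRew {F} (R : Set (Tm F × Tm F)) : Tm F → Tm F → Prop
  | root {l r : Tm F} {σ : ℕ → Tm F} :
      (l, r) ∈ R →
      (∀ f us, subst σ l = Tm.fn f us → ∀ u ∈ us, NFo R u) →
      IRew R (subst σ l) (subst σ r)
  | congr {f : F} {pre post : List (Tm F)} {s t : Tm F} :
      IRew R s t → IRew R (.fn f (pre ++ s :: post)) (.fn f (pre ++ t :: post))

/-- `R` is completely defined: no defined symbol occurs in any normal form. -/
def CompletelyDefined {F} (D : F → Bool) (R : Set (Tm F × Tm F)) : Prop :=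
  ∀ t, NFo R t → IsCtorTerm D t

/-- `Steps r n s t`: a derivation of length `n` from `s` to `t`. -/
def Steps {α} (r : α → α → Prop) : ℕ → α → α → Prop
  | 0, s, t => s = t
  | n + 1, s, t => ∃ u, r s u ∧ Steps r n u t

/-- The innermost runtime complexity `rc^i_R(n)`: the supremum (in `ℕ∞`) of
the lengths of innermost derivations starting from basic terms of size at
most `n`. -/
noncomputable def rcI {F} (D : F → Bool) (R : Set (Tm F × Tm F)) (n : ℕ) : ℕ∞ :=
  sSup {m : ℕ∞ | ∃ (k : ℕ) (t u : Tm F),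
    m = (k : ℕ∞) ∧ Basic D t ∧ t.size ≤ n ∧ Steps (IRew R) k t u}

/-- The set `Tn`: constructor terms, and terms whose normal arguments are
constructor terms and whose safe arguments are again in `Tn`. -/
inductive TnSet {F} (D : F → Bool) (nrm : F → ℕ) : Tm F → Prop
  | ctor {t : Tm F} : IsCtorTerm D t → TnSet D nrm t
  | fn {f : F} {ts : List (Tm F)} :
      (∀ i, i < nrm f → i < ts.length → IsCtorTerm D (ts.getD i default)) →
      (∀ i, nrm f ≤ i → i < ts.length → TnSet D nrm (ts.getD i default)) →
      TnSet D nrm (.fn f ts)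

/-- Renaming of function symbols in a term. -/
def Tm.mapSym {F G} (h : F → G) : Tm F → Tm G
  | .var v => .var v
  | .fn f ts => .fn (h f) (ts.attach.map fun t => t.1.mapSym h)
decreasing_by have := List.sizeOf_lt_of_mem t.2; simp_wf; omega

/-- Whether a term is a constructor term, as a Boolean predicate. -/
def ctorB {F} (D : F → Bool) : Tm F → Bool
  | .var _ => true
  | .fn f ts => !(D f) && ts.attach.all fun t => ctorB D t.1
decreasing_by have := List.sizeOf_lt_of_mem t.2; simp_wf; omega

/-- The extension of a precedence to the marked signature `F ⊕ F` (`Sum.inl f`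
is the original symbol `f`, `Sum.inr f` is the marked symbol `fⁿ`):
`fⁿ ∼ gⁿ` iff `f ∼ g` and `fⁿ ≻ gⁿ` iff `f ≻ g` (constructors are shared). -/
def Precedence.lift {F} (P : Precedence F) : Precedence (F ⊕ F) where
  le a b := P.le (Sum.elim id id a) (Sum.elim id id b)
  refl _ := P.refl _
  trans h1 h2 := P.trans h1 h2
  wf := InvImage.wf (Sum.elim id id) P.wf

/-- Defined symbols of the marked signature: the marked symbols `fⁿ` are the
defined ones. -/
def liftD {F} (D : F → Bool) : F ⊕ F → Bool := Sum.elim D (fun _ => true)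

/-- The predicative interpretation `N` (Definition 4.4), mapping terms to
finite sequences of terms over the marked signature: `N(t) = []` for
constructor terms `t`, and otherwise
`N(f(t₁,…,t_k;t_{k+1},…,t_{k+n})) = [fⁿ(t₁,…,t_k)] ++ N(t_{k+1}) ++ ⋯ ++ N(t_{k+n})`. -/
def NI {F} (D : F → Bool) (nrm : F → ℕ) : Tm F → List (Tm (F ⊕ F))
  | .var _ => []
  | .fn f ts =>
      if ctorB D (.fn f ts) then []
      else Tm.fn (Sum.inr f) ((ts.take (nrm f)).map (Tm.mapSym Sum.inl)) ::
        ((ts.attach.map fun t => NI D nrm t.1).drop (nrm f)).flatten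
decreasing_by have := List.sizeOf_lt_of_mem t.2; simp_wf; omega

/-- One-hole contexts. -/
inductive Ctx (F : Type) : Type
  | hole : Ctx F
  | fn : F → List (Tm F) → Ctx F → List (Tm F) → Ctx F

/-- Filling the hole of a context with a term. -/
def Ctx.fill {F} : Ctx F → Tm F → Tm F
  | .hole, t => t
  | .fn f pre C post, t => .fn f (pre ++ C.fill t :: post)

theorem Epo.exists_blocks {F : Type} {P : Precedence F} {D : F → Bool} {k : ℕ}
    {a b : List (Tm F)} (h : Epo P D k a b) :
    ∃ (bs : List (List (Tm F))) (j : ℕ), bs.flatten = b ∧ bs.length = a.length ∧ j < a.length ∧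
      (∀ i, i < j → ∃ t, bs.getD i [] = [t] ∧ TmEq P (a.getD i default) t) ∧
      Epo P D k [a.getD j default] (bs.getD j []) ∧
      (∀ i, j < i → i < a.length → EpoEq P D k [a.getD i default] (bs.getD i [])) := by
  have singleton : ∀ {u : Tm F} {b : List (Tm F)}, Epo P D k [u] b →
      ∃ (bs : List (List (Tm F))) (j : ℕ), bs.flatten = b ∧ bs.length = [u].length ∧
        j < [u].length ∧
        (∀ i, i < j → ∃ t, bs.getD i [] = [t] ∧ TmEq P ([u].getD i default) t) ∧
        Epo P D k [[u].getD j default] (bs.getD j []) ∧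
        (∀ i, j < i → i < [u].length → EpoEq P D k [[u].getD i default] (bs.getD i [])) := by
    intro u b h
    refine ⟨[b], 0, by simp, by simp, by simp, by simp, by simpa using h, ?_⟩
    intro i h₁ h₂
    simp at h₂
    omega
  cases h with
  | arg h₁ h₂ => exact singleton (.arg h₁ h₂)
  | seq h₁ h₂ h₃ => exact singleton (.seq h₁ h₂ h₃)
  | prec h₁ h₂ h₃ h₄ => exact singleton (.prec h₁ h₂ h₃ h₄)
  | equiv h₁ h₂ h₃ h₄ h₅ h₆ h₇ h₈ h₉ => exact singleton (.equiv h₁ h₂ h₃ h₄ h₅ h₆ h₇ h₈ h₉)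
  | lst h₁ h₂ h₃ h₄ h₅ => exact ⟨_, _, rfl, h₁, h₂, h₃, h₄, h₅⟩

theorem Epo.ne_nil {F : Type} {P : Precedence F} {D : F → Bool} {k : ℕ}
    {a b : List (Tm F)} (h : Epo P D k a b) : a ≠ [] := by
  obtain ⟨_, _, _, _, hj, _⟩ := h.exists_blocks
  rintro rfl
  simp at hj

theorem Epo.cons {F : Type} {P : Precedence F} {D : F → Bool} {k : ℕ}
    {a b : List (Tm F)} (h : Epo P D k a b) (u : Tm F) : Epo P D k (u :: a) (u :: b) := by
  obtain ⟨bs, j, rfl, hlen, hj, hlt, hej, hgt⟩ := h.exists_blocks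
  refine Epo.lst (ss := u :: a) (bs := [u] :: bs) (j := j + 1)
    (by simp [hlen]) (by simpa using hj) ?_ (by simpa using hej) ?_
  · rintro (_ | i) hi
    · exact ⟨u, by simp, by simpa using TmEq.refl u⟩
    · simpa using hlt i (by omega)
  · rintro (_ | i) hi hi'
    · omega
    · simpa using hgt i (by omega) (by simpa using hi')

theorem Epo.append_left {F : Type} {P : Precedence F} {D : F → Bool} {k : ℕ}
    {a b : List (Tm F)} (h : Epo P D k a b) (c : List (Tm F)) :
    Epo P D k (c ++ a) (c ++ b) := by
  induction c with
  | nil => exact h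
  | cons u c ih => exact ih.cons u

theorem Epo.append_right {F : Type} {P : Precedence F} {D : F → Bool} {k : ℕ}
    {a b : List (Tm F)} (h : Epo P D k a b) (c : List (Tm F)) :
    Epo P D k (a ++ c) (b ++ c) := by
  obtain ⟨bs, j, rfl, hlen, hj, hlt, hej, hgt⟩ := h.exists_blocks
  have hflat : bs.flatten ++ c = (bs ++ c.map fun u => [u]).flatten := by
    simp [← List.flatMap_def]
  rw [hflat]
  refine Epo.lst (j := j) (by simp [hlen]) (by simp; omega) ?_ ?_ ?_
  · intro i hi
    rw [List.getD_append _ _ _ _ (by omega), List.getD_append _ _ _ _ (by omega)]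
    exact hlt i hi
  · rw [List.getD_append _ _ _ _ (by omega), List.getD_append _ _ _ _ (by omega)]
    exact hej
  · intro i hi hi'
    by_cases hia : i < a.length
    · rw [List.getD_append _ _ _ _ (by omega), List.getD_append _ _ _ _ (by omega)]
      exact hgt i hi hia
    · have hic : i - a.length < c.length := by
        simp at hi'
        omega
      rw [List.getD_append_right _ _ _ _ (by omega), List.getD_append_right _ _ _ _ (by omega),
        hlen, List.getD_eq_getElem _ _ hic, List.getD_eq_getElem _ _ (by simpa using hic),
        List.getElem_map]
      exact .eq (.refl _)

theorem Epo.nil_right {F : Type} {P : Precedence F} {D : F → Bool} {k : ℕ}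
    {a : List (Tm F)} (ha : a ≠ []) (hD : ∀ u ∈ a, ∃ f ts, u = Tm.fn f ts ∧ D f = true) :
    Epo P D k a [] := by
  have hnil : ∀ i < a.length,
      Epo P D k [a.getD i default] ((List.replicate a.length []).getD i []) := by
    intro i hi
    obtain ⟨f, ts, hu, hf⟩ := hD _ (List.getElem_mem hi)
    rw [List.getD_eq_getElem _ _ hi, List.getD_eq_getElem _ _ (by simpa using hi),
      List.getElem_replicate, hu]
    exact .seq hf (.inl rfl) (by simp)
  have hpos : 0 < a.length := List.length_pos_iff.mpr ha
  have h := Epo.lst (P := P) (D := D) (k := k) (ss := a) (bs := List.replicate a.length [])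
    (j := 0) (by simp) hpos (by simp) (hnil 0 hpos) fun i _ hi => .epo (hnil i hi)
  simpa using h

theorem ctorB_fn {F : Type} (D : F → Bool) (f : F) (ts : List (Tm F)) :
    ctorB D (.fn f ts) = true ↔ D f = false ∧ ∀ t ∈ ts, ctorB D t = true := by
  rw [ctorB]
  simp

theorem ctorB_of_fill {F : Type} {D : F → Bool} {C : Ctx F} {t : Tm F}
    (h : ctorB D (C.fill t) = true) : ctorB D t = true := by
  induction C with
  | hole => exact h
  | fn f pre C post ih => exact ih (((ctorB_fn ..).mp h).2 _ (by simp))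

theorem IsCtorTerm.ctorB_eq_true {F : Type} {D : F → Bool} {t : Tm F} (h : IsCtorTerm D t) :
    ctorB D t = true := by
  induction h with
  | var v => rw [ctorB]
  | fn hf _ ih => exact (ctorB_fn ..).mpr ⟨hf, ih⟩

theorem NI_of_ctorB {F : Type} {D : F → Bool} (nrm : F → ℕ) {t : Tm F} (h : ctorB D t = true) :
    NI D nrm t = [] := by
  cases t with
  | var v => rw [NI]
  | fn f ts => rw [NI, if_pos h]

theorem NI_fn_of_not_ctorB {F : Type} {D : F → Bool} (nrm : F → ℕ) {f : F} {ts : List (Tm F)}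
    (h : ¬ ctorB D (.fn f ts) = true) :
    NI D nrm (.fn f ts) = Tm.fn (Sum.inr f) ((ts.take (nrm f)).map (Tm.mapSym Sum.inl)) ::
      ((ts.drop (nrm f)).map (NI D nrm)).flatten := by
  rw [NI, if_neg h]
  simp [List.map_drop]

theorem root_of_mem_NI {F : Type} {D : F → Bool} {nrm : F → ℕ} (t : Tm F) :
    ∀ u ∈ NI D nrm t, ∃ f ts, u = Tm.fn f ts ∧ liftD D f = true := by
  induction t using NI.induct (D := D) with
  | case1 v => simp [NI]
  | case2 f ts h => simp [NI_of_ctorB nrm h]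
  | case3 f ts h ih =>
    intro u hu
    rw [NI_fn_of_not_ctorB nrm h, List.mem_cons, List.mem_flatten] at hu
    obtain rfl | ⟨l, hl, hu⟩ := hu
    · exact ⟨_, _, rfl, rfl⟩
    · obtain ⟨x, hx, rfl⟩ := List.mem_map.mp hl
      exact ih ⟨x, List.mem_of_mem_drop hx⟩ u hu

theorem TnSet.safe_of_not_ctorB {F : Type} {D : F → Bool} {nrm : F → ℕ} {f : F}
    {pre post : List (Tm F)} {x : Tm F} (h : TnSet D nrm (.fn f (pre ++ x :: post)))
    (hx : ¬ ctorB D x = true) : nrm f ≤ pre.length ∧ TnSet D nrm x := by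
  cases h with
  | ctor h => exact absurd (((ctorB_fn ..).mp h.ctorB_eq_true).2 x (by simp)) hx
  | fn hn hs =>
    have hle : nrm f ≤ pre.length := by
      by_contra! hlt
      exact hx (by simpa using (hn pre.length hlt (by simp)).ctorB_eq_true)
    exact ⟨hle, by simpa using hs pre.length hle (by simp)⟩

theorem NI_fn_append_cons {F : Type} {D : F → Bool} {nrm : F → ℕ} {f : F}
    {pre post : List (Tm F)} {x : Tm F} (hle : nrm f ≤ pre.length)
    (h : ¬ ctorB D (.fn f (pre ++ x :: post)) = true) :
    NI D nrm (.fn f (pre ++ x :: post)) =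
      (Tm.fn (Sum.inr f) ((pre.take (nrm f)).map (Tm.mapSym Sum.inl)) ::
        ((pre.drop (nrm f)).map (NI D nrm)).flatten) ++
      (NI D nrm x ++ (post.map (NI D nrm)).flatten) := by
  rw [NI_fn_of_not_ctorB nrm h, List.take_append_of_le_length hle,
    List.drop_append_of_le_length hle]
  simp

theorem Epo.NI_fn {F : Type} {P : Precedence (F ⊕ F)} {D : F → Bool} {nrm : F → ℕ} {k : ℕ}
    {f : F} {pre post : List (Tm F)} {x y : Tm F} (hle : nrm f ≤ pre.length)
    (hx : ¬ ctorB D x = true) (h : Epo P (liftD D) k (NI D nrm x) (NI D nrm y)) :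
    Epo P (liftD D) k (NI D nrm (.fn f (pre ++ x :: post)))
      (NI D nrm (.fn f (pre ++ y :: post))) := by
  have hfx : ¬ ctorB D (.fn f (pre ++ x :: post)) = true := fun hc =>
    hx (((ctorB_fn ..).mp hc).2 x (by simp))
  by_cases hfy : ctorB D (.fn f (pre ++ y :: post)) = true
  · rw [NI_of_ctorB nrm hfy]
    refine Epo.nil_right ?_ (root_of_mem_NI _)
    simp [NI_fn_append_cons hle hfx]
  · rw [NI_fn_append_cons hle hfx, NI_fn_append_cons hle hfy]
    exact (h.append_right _).append_left _

/-- Lemma 4.12: the predicative embedding is closed under contexts: for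
`s, t ∈ Tn` and a context `C` with `C[s] ∈ Tn`, if `N(s) ≻_ℓ N(t)` then
`N(C[s]) ≻_ℓ N(C[t])`. -/
theorem epo_embed_ctx {F : Type} (P : Precedence F) (D : F → Bool)
    (nrm : F → ℕ) (s t : Tm F) (hs : TnSet D nrm s) (ht : TnSet D nrm t)
    (C : Ctx F) (hC : TnSet D nrm (C.fill s))
    (l : ℕ) (hl : 1 ≤ l)
    (h : Epo (Precedence.lift P) (liftD D) l (NI D nrm s) (NI D nrm t)) :
    Epo (Precedence.lift P) (liftD D) l
      (NI D nrm (C.fill s)) (NI D nrm (C.fill t)) := by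
  induction C with
  | hole => exact h
  | fn f pre C post ih =>
    have hx : ¬ ctorB D (C.fill s) = true := fun hc =>
      h.ne_nil (NI_of_ctorB nrm (ctorB_of_fill hc))
    obtain ⟨hle, hT⟩ := hC.safe_of_not_ctorB hx
    exact (ih hT).NI_fn hle hx
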